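/- Let A=(C,m) be a 3-dimensional toric idealistic cluster and let Q_i be a node of C. If for every pair of distinct labels a,b ∈ {1,2,3} one has #{t ≥ 0 : Q_i(a,b^t) ∈ C} + #{t ≥ 0 : Q_i(b,a^t) ∈ C} ≥ 3, then χ_i > 0. -/

import Mathlib

open Finset

/-!
Common framework: 3-dimensional toric constellations and toric idealistic clusters.
The edge labels `1, 2, 3` of the paper are encoded as `0, 1, 2 : Fin 3`.
-/

/-- A 3-dimensional toric constellation: a finite rooted tree on nodes `0, …, r−1`
(node `0` the root, every child having larger index than its parent), each node having
at most three children, the edges from a node to its children carrying pairwise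
distinct labels in `Fin 3`.  `label j` is the label of the edge from `parent j` to `j`
(irrelevant for the root). -/
structure ToricConstellation (r : ℕ) where
  parent : Fin r → Fin r
  label : Fin r → Fin 3
  parent_lt : ∀ i : Fin r, 0 < (i : ℕ) → (parent i : ℕ) < (i : ℕ)
  parent_root : ∀ i : Fin r, (i : ℕ) = 0 → parent i = i
  label_distinct : ∀ i j : Fin r, 0 < (i : ℕ) → 0 < (j : ℕ) → i ≠ j →
    parent i = parent j → label i ≠ label j

namespace ToricConstellation

variable {r : ℕ}

/-- The ordered triple of vectors of `ℤ³` attached to a node: the root carries the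
standard basis, and the child along the edge labelled `a` of a node with cone
`(u₁,u₂,u₃)` carries the triple obtained by replacing `u_a` with `u₁+u₂+u₃`. -/
def cone (C : ToricConstellation r) (i : Fin r) : Fin 3 → (Fin 3 → ℤ) :=
  if h : 0 < (i : ℕ) then
    Function.update (cone C (C.parent i)) (C.label i) (∑ a, cone C (C.parent i) a)
  else fun a => Pi.single a 1
termination_by (i : ℕ)
decreasing_by all_goals exact C.parent_lt i h

/-- `v(Q) = u₁ + u₂ + u₃`, the sum of the cone vectors of a node. -/
def v (C : ToricConstellation r) (i : Fin r) : Fin 3 → ℤ := ∑ a, cone C i a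

/-- `Prox C j i` means `j → i`, i.e. `Q_j` is proximate to `Q_i`:
`j ≠ i` and `v(Q_i)` is an entry of `cone(Q_j)`. -/
def Prox (C : ToricConstellation r) (j i : Fin r) : Prop :=
  j ≠ i ∧ ∃ a : Fin 3, cone C j a = v C i

instance (C : ToricConstellation r) (j i : Fin r) : Decidable (C.Prox j i) := by
  unfold Prox; infer_instance

/-- `inChain C i a b j = true` iff `j = Q_i(a, b^t)` for some `t ≥ 0`, i.e. `j` is
reached from `i` by one edge labelled `a` followed by `t` edges labelled `b`. -/
def inChain (C : ToricConstellation r) (i : Fin r) (a b : Fin 3) (j : Fin r) : Bool :=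
  if h : 0 < (j : ℕ) then
    (decide (C.parent j = i) && decide (C.label j = a)) ||
      (decide (C.label j = b) && inChain C i a b (C.parent j))
  else false
termination_by (j : ℕ)
decreasing_by exact C.parent_lt j h

/-- `LinProx C j i` means `j ↠ i`, i.e. `Q_j` is linearly proximate to `Q_i`. -/
def LinProx (C : ToricConstellation r) (j i : Fin r) : Prop :=
  ∃ a b : Fin 3, a ≠ b ∧ inChain C i a b j = true

instance (C : ToricConstellation r) (j i : Fin r) : Decidable (C.LinProx j i) := by
  unfold LinProx; infer_instance

/-- `j` is a child of `i`. -/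
def IsChild (C : ToricConstellation r) (j i : Fin r) : Prop :=
  0 < (j : ℕ) ∧ C.parent j = i

instance (C : ToricConstellation r) (j i : Fin r) : Decidable (C.IsChild j i) := by
  unfold IsChild; infer_instance

/-- The set `S_i` of labels of the edges on the path from the root to `Q_i`. -/
def labelsUnder (C : ToricConstellation r) (i : Fin r) : Finset (Fin 3) :=
  if h : 0 < (i : ℕ) then insert (C.label i) (labelsUnder C (C.parent i)) else ∅
termination_by (i : ℕ)
decreasing_by exact C.parent_lt i h

/-- `i` is a weak ancestor of `j` (`i = j` or `i` a strict ancestor of `j`). -/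
def anc (C : ToricConstellation r) (i j : Fin r) : Bool :=
  decide (i = j) || (if h : 0 < (j : ℕ) then anc C i (C.parent j) else false)
termination_by (j : ℕ)
decreasing_by exact C.parent_lt j h

/-- The set of nodes weakly above `i` (`i` together with its descendants). -/
def weakAbove (C : ToricConstellation r) (i : Fin r) : Finset (Fin r) :=
  univ.filter (fun j => anc C i j = true)

end ToricConstellation

/-- A 3-dimensional toric cluster: a toric constellation together with a positive
integer weight for each node. -/
structure ToricCluster (r : ℕ) extends ToricConstellation r where
  m : Fin r → ℤ
  m_pos : ∀ j, 0 < m j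

namespace ToricCluster

open ToricConstellation

variable {r : ℕ}

/-- `M_{Q_i}(a,b) := Σ_{t ≥ 0, Q_i(a,b^t) ∈ C} m_{Q_i(a,b^t)}`. -/
def M (A : ToricCluster r) (i : Fin r) (a b : Fin 3) : ℤ :=
  ∑ j ∈ univ.filter (fun j => inChain A.toToricConstellation i a b j = true), A.m j

/-- The cluster is idealistic: the linear proximity inequalities
`M_{Q_i}(a,b) + M_{Q_i}(b,a) ≤ m_{Q_i}` hold. -/
def Idealistic (A : ToricCluster r) : Prop :=
  ∀ i : Fin r, ∀ a b : Fin 3, a ≠ b → A.M i a b + A.M i b a ≤ A.m i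

/-- The set of nodes `j` proximate to `i` (`j → i`). -/
def proxSet (A : ToricCluster r) (i : Fin r) : Finset (Fin r) :=
  univ.filter (fun j => Prox A.toToricConstellation j i)

/-- `B_i`: the set of nodes to which `i` is proximate. -/
def Bset (A : ToricCluster r) (i : Fin r) : Finset (Fin r) :=
  univ.filter (fun j => Prox A.toToricConstellation i j)

/-- `A_i`: the children `k` of `i` for which there is no `l` with `i → l` and `k → l`. -/
def Aset (A : ToricCluster r) (i : Fin r) : Finset (Fin r) :=
  univ.filter (fun k => IsChild A.toToricConstellation k i ∧
    ¬ ∃ l, Prox A.toToricConstellation i l ∧ Prox A.toToricConstellation k l)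

/-- The Euler characteristic `χ_i = χ(E_i°)`. -/
def chi (A : ToricCluster r) (i : Fin r) : ℤ :=
  3 + A.m i * (A.m i - 3)
    - ∑ j ∈ A.proxSet i, A.m j * (A.m j - 1)
    + ∑ j ∈ A.proxSet i,
        (A.m j - ∑ k ∈ (A.proxSet i).filter
          (fun k => LinProx A.toToricConstellation k j), A.m k)
    + ∑ j ∈ A.Bset i,
        (A.m i - ∑ k ∈ (A.proxSet j).filter
          (fun k => LinProx A.toToricConstellation k i), A.m k)
    - ((A.Aset i).card : ℤ) - 2 * ((A.Bset i).card : ℤ)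
    + (((A.Bset i).card.choose 2 : ℕ) : ℤ)

/-- `D_i = m_i² − Σ_{j→i} m_j²`. -/
def D (A : ToricCluster r) (i : Fin r) : ℤ :=
  A.m i ^ 2 - ∑ j ∈ A.proxSet i, A.m j ^ 2

/-- `r_{ab} = m_i − M_{Q_i}(a,b) − M_{Q_i}(b,a)`. -/
def rab (A : ToricCluster r) (i : Fin r) (a b : Fin 3) : ℤ :=
  A.m i - A.M i a b - A.M i b a

/-- `R_i = r̂_{12} + r̂_{13} + r̂_{23}`, where `r̂_{ab} = r_{ab}` if the remaining third
label does not appear under `Q_i`, and `r̂_{ab} = 0` otherwise.  (Labels `1,2,3` are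
encoded as `0,1,2 : Fin 3`.) -/
def R (A : ToricCluster r) (i : Fin r) : ℤ :=
  (if (2 : Fin 3) ∉ labelsUnder A.toToricConstellation i then A.rab i 0 1 else 0)
  + (if (1 : Fin 3) ∉ labelsUnder A.toToricConstellation i then A.rab i 0 2 else 0)
  + (if (0 : Fin 3) ∉ labelsUnder A.toToricConstellation i then A.rab i 1 2 else 0)

/-- `T_i = 3 − #A_i − 2·#B_i + (#B_i choose 2)`. -/
def T (A : ToricCluster r) (i : Fin r) : ℤ :=
  3 - ((A.Aset i).card : ℤ) - 2 * ((A.Bset i).card : ℤ)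
    + (((A.Bset i).card.choose 2 : ℕ) : ℤ)

/-- The nodes to which `i` is proximate, of smaller index: the sums in the recursive
definitions of the numerical data range over the nodes to which `i` is proximate,
which are ancestors of `i` and hence have smaller index (making the recursion
well-founded). -/
def anteSet (A : ToricCluster r) (i : Fin r) : Finset (Fin r) :=
  univ.filter (fun j => (j : ℕ) < (i : ℕ) ∧ Prox A.toToricConstellation i j)

/-- The numerical datum `N_i := m_i + Σ_{j : i→j} N_j`. -/
def N (A : ToricCluster r) (i : Fin r) : ℤ :=
  A.m i + ∑ j ∈ (A.anteSet i).attach, N A j.1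
termination_by (i : ℕ)
decreasing_by
  have hj := j.2
  simp only [anteSet, Finset.mem_filter] at hj
  exact hj.2.1

/-- The numerical datum `ν_i := 3 + Σ_{j : i→j} (ν_j − 1)`. -/
def nu (A : ToricCluster r) (i : Fin r) : ℤ :=
  3 + ∑ j ∈ (A.anteSet i).attach, (nu A j.1 - 1)
termination_by (i : ℕ)
decreasing_by
  have hj := j.2
  simp only [anteSet, Finset.mem_filter] at hj
  exact hj.2.1

end ToricCluster


open ToricConstellation ToricCluster

namespace ToricConstellation

section Vectors

variable {r : ℕ} (C : ToricConstellation r)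

/-- The coordinate change from the cone of the child along `a` to the cone of its parent. -/
def shear (a : Fin 3) (x : Fin 3 → ℤ) : Fin 3 → ℤ :=
  fun k => if k = a then x a else x k + x a

/-- The labels on the path from the root to a node, in order. -/
def word (i : Fin r) : List (Fin 3) :=
  if h : 0 < (i : ℕ) then word (C.parent i) ++ [C.label i] else []
termination_by (i : ℕ)
decreasing_by exact C.parent_lt i h

lemma shear_injective (a : Fin 3) : Function.Injective (shear a) := by
  intro x y hxy
  have ha : x a = y a := by simpa [shear] using congrFun hxy a
  funext k
  by_cases hk : k = a
  · rw [hk, ha]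
  · simpa [shear, hk, ha] using congrFun hxy k

lemma foldr_shear_injective (l : List (Fin 3)) :
    Function.Injective (fun x => l.foldr shear x) := by
  induction l with
  | nil => exact fun x y h => h
  | cons a l ih => exact fun x y h => ih (shear_injective a h)

lemma foldr_shear_one_pos (l : List (Fin 3)) (k : Fin 3) : 0 < l.foldr shear 1 k := by
  induction l generalizing k with
  | nil => simp
  | cons a l ih =>
    have h1 := ih k
    have h2 := ih a
    simp only [List.foldr_cons, shear]
    split_ifs <;> omega

lemma shear_lt_shear {a k : Fin 3} {x : Fin 3 → ℤ} (hx : 0 < x k) (hk : k ≠ a) :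
    shear a x a < shear a x k := by
  simp [shear, hk, hx]

lemma foldr_shear_one_injective :
    Function.Injective (fun l : List (Fin 3) => l.foldr shear 1) := by
  have key : ∀ (a : Fin 3) (l : List (Fin 3)), (a :: l).foldr shear 1 ≠ 1 := by
    intro a l h
    obtain ⟨k, hk⟩ := exists_ne a
    have := shear_lt_shear (foldr_shear_one_pos l k) hk
    rw [List.foldr_cons] at h
    simp [h] at this
  intro l
  induction l with
  | nil =>
    rintro (_ | ⟨a, l⟩) h
    · rfl
    · exact absurd h.symm (key a l)
  | cons a l ih =>
    rintro (_ | ⟨b, l'⟩) h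
    · exact absurd h (key a l)
    · simp only [List.foldr_cons] at h
      obtain rfl : a = b := by
        by_contra hab
        have h1 := shear_lt_shear (foldr_shear_one_pos l b) (Ne.symm hab)
        have h2 := shear_lt_shear (foldr_shear_one_pos l' a) hab
        rw [h] at h1
        exact lt_asymm h1 h2
      rw [ih (shear_injective a h)]

lemma cone_of_pos {i : Fin r} (h : 0 < (i : ℕ)) :
    C.cone i = Function.update (C.cone (C.parent i)) (C.label i) (C.v (C.parent i)) := by
  rw [cone, dif_pos h, v]

lemma cone_label {i : Fin r} (h : 0 < (i : ℕ)) : C.cone i (C.label i) = C.v (C.parent i) := by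
  rw [cone_of_pos C h, Function.update_self]

lemma cone_of_ne_label {i : Fin r} (h : 0 < (i : ℕ)) {a : Fin 3} (ha : a ≠ C.label i) :
    C.cone i a = C.cone (C.parent i) a := by
  rw [cone_of_pos C h, Function.update_of_ne ha]

lemma sum_smul_cone (i : Fin r) (x : Fin 3 → ℤ) :
    ∑ k, x k • C.cone i k = (C.word i).foldr shear x := by
  by_cases h : 0 < (i : ℕ)
  · rw [word, dif_pos h, List.foldr_append, List.foldr_cons, List.foldr_nil,
      ← sum_smul_cone (C.parent i) (shear (C.label i) x), cone_of_pos C h, v]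
    generalize C.cone (C.parent i) = u
    generalize C.label i = a
    funext t
    fin_cases a <;> simp [Fin.sum_univ_three, shear, Function.update] <;> ring
  · rw [word, dif_neg h, cone, dif_neg h]
    funext t
    simp [Finset.sum_apply, Pi.single_apply]
termination_by (i : ℕ)
decreasing_by exact C.parent_lt i h

lemma v_eq_foldr (i : Fin r) : C.v i = (C.word i).foldr shear 1 := by
  simp [← sum_smul_cone, v]

lemma cone_injective (i : Fin r) : Function.Injective (C.cone i) := by
  have h (a : Fin 3) : C.cone i a = (C.word i).foldr shear (Pi.single a 1) := by
    rw [← sum_smul_cone]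
    simp [Pi.single_apply]
  intro a b hab
  rw [h, h] at hab
  have := congrFun (foldr_shear_injective _ hab) a
  by_contra hne
  simp [hne] at this

lemma word_injective : Function.Injective C.word := by
  suffices ∀ i j : Fin r, C.word i = C.word j → i = j from fun i j => this i j
  intro i j hij
  induction hn : (i : ℕ) using Nat.strong_induction_on generalizing i j with
  | _ n ih =>
    subst hn
    rw [word, word.eq_def C j] at hij
    by_cases hi : 0 < (i : ℕ) <;> by_cases hj : 0 < (j : ℕ) <;> simp [hi, hj] at hij
    · have hp := ih _ (C.parent_lt i hi) _ _ hij.1 rfl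
      by_contra hne
      exact C.label_distinct i j hi hj hne hp hij.2
    · exact Fin.ext (by omega)

lemma v_injective : Function.Injective C.v := by
  intro i j hij
  rw [v_eq_foldr, v_eq_foldr] at hij
  exact C.word_injective (foldr_shear_one_injective hij)

lemma cone_eq_v_iff {i j : Fin r} {a : Fin 3} :
    C.cone j a = C.v i ↔ 0 < (j : ℕ) ∧
      ((C.label j = a ∧ C.parent j = i) ∨ (C.label j ≠ a ∧ C.cone (C.parent j) a = C.v i)) := by
  by_cases h : 0 < (j : ℕ)
  · by_cases ha : C.label j = a
    · subst ha
      simp [h, cone_label, C.v_injective.eq_iff]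
    · simp [h, ha, cone_of_ne_label C h (Ne.symm ha)]
  · simp only [h, false_and, iff_false]
    rw [cone, dif_neg h]
    intro he
    obtain ⟨b, hb⟩ := exists_ne a
    have h1 := foldr_shear_one_pos (C.word i) b
    rw [← v_eq_foldr, ← he] at h1
    simp [hb] at h1

lemma lt_of_cone_eq_v {i j : Fin r} {a : Fin 3} (h : C.cone j a = C.v i) : i < j := by
  obtain ⟨hj, ⟨-, hp⟩ | ⟨-, hp⟩⟩ := C.cone_eq_v_iff.1 h
  · exact hp ▸ C.parent_lt j hj
  · exact (lt_of_cone_eq_v hp).trans (C.parent_lt j hj)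
termination_by (j : ℕ)
decreasing_by exact C.parent_lt j hj

lemma prox_iff {i j : Fin r} : C.Prox j i ↔ ∃ a, C.cone j a = C.v i :=
  ⟨fun h => h.2, fun ⟨a, ha⟩ => ⟨(C.lt_of_cone_eq_v ha).ne', a, ha⟩⟩

end Vectors

section Branches

variable {r : ℕ} (C : ToricConstellation r)

/-- `k` is reached from `j` by a (possibly empty) path with labels in `S`. -/
inductive Reach (S : Finset (Fin 3)) (j : Fin r) : Fin r → Prop
  | refl : Reach S j j
  | step (k : Fin r) : 0 < (k : ℕ) → C.label k ∈ S → Reach S j (C.parent k) → Reach S j k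

variable {C}

lemma Reach.le {S : Finset (Fin 3)} {j k : Fin r} (h : C.Reach S j k) : j ≤ k := by
  induction h with
  | refl => exact le_rfl
  | step k hk _ _ ih => exact ih.trans (C.parent_lt k hk).le

lemma IsChild.lt {c j : Fin r} (h : C.IsChild c j) : j < c := h.2 ▸ C.parent_lt c h.1

lemma IsChild.eq_of_label_eq {c d j : Fin r} (hc : C.IsChild c j) (hd : C.IsChild d j)
    (h : C.label c = C.label d) : c = d := by
  by_contra hne
  exact C.label_distinct c d hc.1 hd.1 hne (hc.2.trans hd.2.symm) h

lemma Reach.eq_of_isChild {S S' : Finset (Fin 3)} {j c d k : Fin r} (hc : C.IsChild c j)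
    (hd : C.IsChild d j) (h : C.Reach S c k) (h' : C.Reach S' d k) : c = d := by
  induction h with
  | refl =>
    cases h' with
    | refl => rfl
    | step _ _ _ h'' => exact absurd (h''.le.trans_eq hc.2) (not_le.2 hd.lt)
  | step k hk hl hr ih =>
    cases h' with
    | refl => exact absurd (hr.le.trans_eq hd.2) (not_le.2 hc.lt)
    | step _ _ _ h'' => exact ih h''

lemma reach_iff {S : Finset (Fin 3)} {j k : Fin r} :
    C.Reach S j k ↔ k = j ∨ ∃ a ∈ S, ∃ c, C.IsChild c j ∧ C.label c = a ∧ C.Reach S c k := by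
  constructor
  · intro h
    induction h with
    | refl => exact Or.inl rfl
    | step k hk hl _ ih =>
      right
      obtain ih | ⟨a, ha, c, hc, hca, hr⟩ := ih
      · exact ⟨_, hl, k, ⟨hk, ih⟩, rfl, .refl⟩
      · exact ⟨a, ha, c, hc, hca, .step k hk hl hr⟩
  · rintro (rfl | ⟨a, ha, c, hc, hca, hr⟩)
    · exact .refl
    · induction hr with
      | refl => exact .step c hc.1 (hca ▸ ha) (hc.2 ▸ .refl)
      | step k hk hl _ ih => exact .step k hk hl ih

variable (C)

open Classical in
/-- The nodes reached from `j` by a path with labels in `S`. -/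
noncomputable def reachSet (S : Finset (Fin 3)) (j : Fin r) : Finset (Fin r) :=
  univ.filter (C.Reach S j)

open Classical in
/-- The nodes reached from `j` by an edge labelled `a` followed by a path with labels in `S`. -/
noncomputable def branch (S : Finset (Fin 3)) (j : Fin r) (a : Fin 3) : Finset (Fin r) :=
  univ.filter fun k => ∃ c, C.IsChild c j ∧ C.label c = a ∧ C.Reach S c k

variable {C}

lemma mem_branch {S : Finset (Fin 3)} {j k : Fin r} {a : Fin 3} :
    k ∈ C.branch S j a ↔ ∃ c, C.IsChild c j ∧ C.label c = a ∧ C.Reach S c k := by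
  simp [branch]

lemma branch_eq_reachSet {S : Finset (Fin 3)} {j c : Fin r} (hc : C.IsChild c j) :
    C.branch S j (C.label c) = C.reachSet S c := by
  ext k
  simp only [mem_branch, reachSet, mem_filter, mem_univ, true_and]
  exact ⟨fun ⟨d, hd, hl, hr⟩ => hc.eq_of_label_eq hd hl.symm ▸ hr, fun h => ⟨c, hc, rfl, h⟩⟩

lemma branch_eq_empty {S : Finset (Fin 3)} {j : Fin r} {a : Fin 3}
    (h : ¬ ∃ c, C.IsChild c j ∧ C.label c = a) : C.branch S j a = ∅ := by
  rw [Finset.eq_empty_iff_forall_notMem]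
  intro k hk
  obtain ⟨c, hc, hl, -⟩ := mem_branch.1 hk
  exact h ⟨c, hc, hl⟩

lemma sum_reachSet {M : Type*} [AddCommMonoid M] (S : Finset (Fin 3)) (j : Fin r)
    (f : Fin r → M) :
    ∑ k ∈ C.reachSet S j, f k = f j + ∑ a ∈ S, ∑ k ∈ C.branch S j a, f k := by
  have heq : C.reachSet S j = insert j (S.biUnion (C.branch S j)) := by
    ext k
    simp only [reachSet, mem_filter, mem_univ, true_and, mem_insert, mem_biUnion, mem_branch]
    exact reach_iff
  rw [heq, sum_insert, sum_biUnion]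
  · intro a _ b _ hab
    refine disjoint_left.2 fun k hk hk' => hab ?_
    obtain ⟨c, hc, rfl, hr⟩ := mem_branch.1 hk
    obtain ⟨d, hd, rfl, hr'⟩ := mem_branch.1 hk'
    rw [hr.eq_of_isChild hc hd hr']
  · simp only [mem_biUnion, mem_branch, not_exists, not_and]
    rintro a - c hc - hr
    exact absurd hr.le (not_le.2 hc.lt)

lemma inChain_iff {i k : Fin r} {a b : Fin 3} :
    C.inChain i a b k = true ↔ 0 < (k : ℕ) ∧ ((C.parent k = i ∧ C.label k = a) ∨
      (C.label k = b ∧ C.inChain i a b (C.parent k) = true)) := by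
  rw [inChain]
  by_cases h : 0 < (k : ℕ) <;> simp [h]

lemma inChain_iff_mem_branch {i k : Fin r} {a b : Fin 3} :
    C.inChain i a b k = true ↔ k ∈ C.branch {b} i a := by
  rw [mem_branch]
  constructor
  · intro h
    induction hn : (k : ℕ) using Nat.strong_induction_on generalizing k with
    | _ n ih =>
      obtain ⟨hk, ⟨hp, hl⟩ | ⟨hl, hp⟩⟩ := inChain_iff.1 h
      · exact ⟨k, ⟨hk, hp⟩, hl, .refl⟩
      · obtain ⟨c, hc, hca, hr⟩ := ih _ (hn ▸ C.parent_lt k hk) hp rfl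
        exact ⟨c, hc, hca, .step k hk (by simp [hl]) hr⟩
  · rintro ⟨c, hc, hca, hr⟩
    induction hr with
    | refl => exact inChain_iff.2 ⟨hc.1, Or.inl ⟨hc.2, hca⟩⟩
    | step k hk hl _ ih => exact inChain_iff.2 ⟨hk, Or.inr ⟨by simpa using hl, ih⟩⟩

lemma filter_inChain (i : Fin r) (a b : Fin 3) :
    univ.filter (fun k => C.inChain i a b k = true) = C.branch {b} i a := by
  ext k
  simp [inChain_iff_mem_branch]

lemma cone_eq_v_iff_mem_branch {i k : Fin r} {a : Fin 3} :
    C.cone k a = C.v i ↔ k ∈ C.branch {a}ᶜ i a := by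
  rw [mem_branch]
  constructor
  · intro h
    induction hn : (k : ℕ) using Nat.strong_induction_on generalizing k with
    | _ n ih =>
      obtain ⟨hk, ⟨hl, hp⟩ | ⟨hl, hp⟩⟩ := C.cone_eq_v_iff.1 h
      · exact ⟨k, ⟨hk, hp⟩, hl, .refl⟩
      · obtain ⟨c, hc, hca, hr⟩ := ih _ (hn ▸ C.parent_lt k hk) hp rfl
        exact ⟨c, hc, hca, .step k hk (by simp [hl]) hr⟩
  · rintro ⟨c, hc, hca, hr⟩
    induction hr with
    | refl => exact C.cone_eq_v_iff.2 ⟨hc.1, Or.inl ⟨hca, hc.2⟩⟩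
    | step k hk hl _ ih => exact C.cone_eq_v_iff.2 ⟨hk, Or.inr ⟨by simpa using hl, ih⟩⟩

lemma lt_of_inChain {i k : Fin r} {a b : Fin 3} (h : C.inChain i a b k = true) : i < k := by
  obtain ⟨c, hc, -, hr⟩ := mem_branch.1 (inChain_iff_mem_branch.1 h)
  exact hc.lt.trans_le hr.le

lemma cone_of_inChain {i k : Fin r} {a b : Fin 3} (hab : a ≠ b)
    (h : C.inChain i a b k = true) : C.cone k a = C.v i := by
  rw [cone_eq_v_iff_mem_branch]
  obtain ⟨c, hc, hca, hr⟩ := mem_branch.1 (inChain_iff_mem_branch.1 h)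
  refine mem_branch.2 ⟨c, hc, hca, ?_⟩
  clear h
  induction hr with
  | refl => exact .refl
  | step k hk hl _ ih => exact .step k hk (by simp_all [eq_comm]) ih

/-- Apart from its parent, a node is linearly proximate to at most one node, along at most one
chain. -/
lemma inChain_unique {i j k : Fin r} {a b a' b' : Fin 3} (hab : a ≠ b) (hab' : a' ≠ b')
    (h : C.inChain i a b k = true) (h' : C.inChain j a' b' k = true)
    (hi : C.parent k ≠ i) (hj : C.parent k ≠ j) : i = j ∧ a = a' ∧ b = b' := by
  induction hn : (k : ℕ) using Nat.strong_induction_on generalizing k with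
  | _ n ih =>
    obtain ⟨hk, hh | ⟨hb, hp⟩⟩ := inChain_iff.1 h
    · exact absurd hh.1 hi
    obtain ⟨-, hh | ⟨hb', hp'⟩⟩ := inChain_iff.1 h'
    · exact absurd hh.1 hj
    have hbb := hb.symm.trans hb'
    obtain ⟨hpk, h1⟩ := inChain_iff.1 hp
    obtain ⟨-, h2⟩ := inChain_iff.1 hp'
    by_cases hci : C.parent (C.parent k) = i <;> by_cases hcj : C.parent (C.parent k) = j
    · have hla : C.label (C.parent k) = a := by
        rcases h1 with h1 | h1
        · exact h1.2
        · exact absurd (hci ▸ lt_of_inChain h1.2) (lt_irrefl _)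
      have hla' : C.label (C.parent k) = a' := by
        rcases h2 with h2 | h2
        · exact h2.2
        · exact absurd (hcj ▸ lt_of_inChain h2.2) (lt_irrefl _)
      exact ⟨hci.symm.trans hcj, hla.symm.trans hla', hbb⟩
    · have hla : C.label (C.parent k) = a := by
        rcases h1 with h1 | h1
        · exact h1.2
        · exact absurd (hci ▸ lt_of_inChain h1.2) (lt_irrefl _)
      rcases h2 with h2 | h2
      · exact absurd h2.1 hcj
      · exact absurd (hla.symm.trans (h2.1.trans hbb.symm)) hab
    · have hla' : C.label (C.parent k) = a' := by
        rcases h2 with h2 | h2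
        · exact h2.2
        · exact absurd (hcj ▸ lt_of_inChain h2.2) (lt_irrefl _)
      rcases h1 with h1 | h1
      · exact absurd h1.1 hci
      · exact absurd (hla'.symm.trans (h1.1.trans hbb)) hab'
    · exact ih _ (hn ▸ C.parent_lt k hk) hp hp' hci hcj rfl

end Branches

end ToricConstellation

namespace ToricCluster

variable {r : ℕ} (A : ToricCluster r)

lemma M_eq (i : Fin r) (a b : Fin 3) :
    A.M i a b = ∑ k ∈ A.branch {b} i a, A.m k := by
  rw [M, filter_inChain]

lemma M_nonneg (i : Fin r) (a b : Fin 3) : 0 ≤ A.M i a b :=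
  Finset.sum_nonneg fun k _ => (A.m_pos k).le

lemma card_branch_le_M (i : Fin r) (a b : Fin 3) : ((A.branch {b} i a).card : ℤ) ≤ A.M i a b := by
  rw [M_eq, Finset.card_eq_sum_ones, Nat.cast_sum]
  exact Finset.sum_le_sum fun k _ => by exact_mod_cast A.m_pos k

variable {A}

/-- The squared weights above a node are bounded by the product of the weights along the two
extremal paths. -/
lemma sum_sq_reachSet_le (hA : A.Idealistic) {b c : Fin 3} (hbc : b ≠ c) (j : Fin r) :
    ∑ k ∈ A.reachSet {b, c} j, A.m k ^ 2
        ≤ (A.m j + A.M j b b) * (A.m j + A.M j c c) ∧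
      (0 < A.M j b b → 0 < A.M j c c → ∑ k ∈ A.reachSet {b, c} j, A.m k ^ 2
        < (A.m j + A.M j b b) * (A.m j + A.M j c c)) := by
  have step (a : Fin 3) :
      ∑ k ∈ A.branch {b, c} j a, A.m k ^ 2 ≤ A.M j a b * A.M j a c := by
    by_cases h : ∃ d, A.IsChild d j ∧ A.label d = a
    · obtain ⟨d, hd, rfl⟩ := h
      have := (sum_sq_reachSet_le hA hbc d).1
      simpa only [M_eq, branch_eq_reachSet hd, sum_reachSet, sum_singleton] using this
    · simp [branch_eq_empty h, M_eq]
  have hb := step b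
  have hc := step c
  rw [sum_reachSet, sum_pair hbc]
  have h0 := hA j b c hbc
  have h1 := A.M_nonneg j b c
  have h2 := A.M_nonneg j c b
  have h3 := A.M_nonneg j b b
  have h4 := A.M_nonneg j c c
  have h5 := mul_nonneg h3 (show 0 ≤ A.m j - A.M j b c by linarith)
  have h6 := mul_nonneg h4 (show 0 ≤ A.m j - A.M j c b by linarith)
  constructor
  · nlinarith [mul_nonneg h3 h4]
  · intro h7 h8
    nlinarith [mul_pos h7 h8]
termination_by r - (j : ℕ)
decreasing_by
  have := hd.lt
  omega

/-- The weights in the branch along `a` of a node: either there is no such branch, or its squared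
weights are bounded by the product of the weights along its two extremal chains, strictly so when
both chains have at least two nodes. -/
lemma branch_estimate (hA : A.Idealistic) (i : Fin r) {a b c : Fin 3} (hbc : b ≠ c)
    (ha : ({a} : Finset (Fin 3))ᶜ = {b, c}) :
    ((A.branch {b} i a).card = 0 ∧ (A.branch {c} i a).card = 0 ∧ A.M i a b = 0 ∧ A.M i a c = 0 ∧
        ∑ k ∈ A.branch {a}ᶜ i a, A.m k ^ 2 = 0) ∨
      (1 ≤ A.M i a b ∧ 1 ≤ A.M i a c ∧
        ∑ k ∈ A.branch {a}ᶜ i a, A.m k ^ 2 ≤ A.M i a b * A.M i a c ∧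
        (2 ≤ (A.branch {b} i a).card → 2 ≤ (A.branch {c} i a).card →
          ∑ k ∈ A.branch {a}ᶜ i a, A.m k ^ 2 < A.M i a b * A.M i a c)) := by
  rw [ha]
  by_cases h : ∃ d, A.IsChild d i ∧ A.label d = a
  · right
    obtain ⟨d, hd, rfl⟩ := h
    have hM (e : Fin 3) : A.M i (A.label d) e = A.m d + A.M d e e := by
      simp only [M_eq, branch_eq_reachSet hd, sum_reachSet, sum_singleton]
    have hcard (e : Fin 3) (he : 2 ≤ (A.branch {e} i (A.label d)).card) : 0 < A.M d e e := by
      rw [branch_eq_reachSet hd, Finset.card_eq_sum_ones, sum_reachSet, sum_singleton,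
        ← Finset.card_eq_sum_ones] at he
      have := A.card_branch_le_M d e e
      omega
    rw [hM, hM, branch_eq_reachSet hd]
    have hp := A.m_pos d
    have hb := A.M_nonneg d b b
    have hc := A.M_nonneg d c c
    obtain ⟨h1, h2⟩ := sum_sq_reachSet_le hA hbc d
    exact ⟨by omega, by omega, h1, fun hb hc => h2 (hcard b hb) (hcard c hc)⟩
  · left
    simp [branch_eq_empty h, M_eq]

lemma sum_proxSet (i : Fin r) (f : Fin r → ℤ) :
    ∑ k ∈ A.proxSet i, f k = ∑ a, ∑ k ∈ A.branch {a}ᶜ i a, f k := by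
  have : A.proxSet i = univ.biUnion fun a => A.branch {a}ᶜ i a := by
    ext k
    simp [proxSet, prox_iff, cone_eq_v_iff_mem_branch]
  rw [this, Finset.sum_biUnion]
  intro a _ b _ hab
  refine disjoint_left.2 fun k hk hk' => hab ?_
  rw [← cone_eq_v_iff_mem_branch] at hk hk'
  exact A.cone_injective k (hk.trans hk'.symm)

/-- The ordered pairs of distinct labels. -/
def labelPairs : Finset (Fin 3 × Fin 3) := univ.filter fun p => p.1 ≠ p.2

/-- Each node is counted at most twice among its linear proximities to nodes
proximate to `i` and the chains starting at `i` through it. -/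
lemma card_linProx_add_card_chains_le (i k : Fin r) :
    ((A.proxSet i).filter (fun j => A.LinProx k j)).card +
      (labelPairs.filter (fun p => A.inChain i p.1 p.2 k = true)).card ≤ 2 := by
  by_cases hp : A.parent k = i
  · have h1 : (A.proxSet i).filter (fun j => A.LinProx k j) = ∅ := by
      rw [Finset.filter_eq_empty_iff]
      rintro j hj ⟨a, b, -, hc⟩
      obtain ⟨t, ht⟩ := prox_iff _ |>.1 (mem_filter.1 hj).2
      have hij := A.lt_of_cone_eq_v ht
      obtain ⟨-, h | h⟩ := inChain_iff.1 hc
      · exact hij.ne (hp.symm.trans h.1)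
      · exact lt_asymm hij (hp ▸ lt_of_inChain h.2)
    have h2 : labelPairs.filter (fun p => A.inChain i p.1 p.2 k = true)
        ⊆ labelPairs.filter (fun p => p.1 = A.label k) := by
      intro p hp'
      rw [mem_filter] at hp' ⊢
      refine ⟨hp'.1, ?_⟩
      obtain ⟨-, h | h⟩ := inChain_iff.1 hp'.2
      · exact h.2.symm
      · exact absurd (hp ▸ lt_of_inChain h.2) (lt_irrefl _)
    have h3 : ∀ a : Fin 3, (labelPairs.filter (fun p => p.1 = a)).card ≤ 2 := by decide
    rw [h1, Finset.card_empty, zero_add]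
    exact (Finset.card_le_card h2).trans (h3 _)
  · rcases (labelPairs.filter (fun p => A.inChain i p.1 p.2 k = true)).eq_empty_or_nonempty
      with he | ⟨p, hpm⟩
    · have h1 : (((A.proxSet i).filter (fun j => A.LinProx k j)).erase (A.parent k)).card ≤ 1 := by
        refine Finset.card_le_one.2 fun j hj j' hj' => ?_
        simp only [mem_erase, mem_filter] at hj hj'
        obtain ⟨hne, -, a, b, hab, hc⟩ := hj
        obtain ⟨hne', -, a', b', hab', hc'⟩ := hj'
        exact (inChain_unique hab hab' hc hc' hne.symm hne'.symm).1
      have h2 := Finset.pred_card_le_card_erase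
        (s := (A.proxSet i).filter (fun j => A.LinProx k j)) (a := A.parent k)
      rw [he, Finset.card_empty]
      omega
    · have h1 : (labelPairs.filter (fun p => A.inChain i p.1 p.2 k = true)).card ≤ 1 := by
        refine Finset.card_le_one.2 fun p hp1 q hq => ?_
        simp only [labelPairs, mem_filter, mem_univ, true_and] at hp1 hq
        exact Prod.ext_iff.2 (inChain_unique hp1.1 hq.1 hp1.2 hq.2 hp hp).2
      simp only [labelPairs, mem_filter, mem_univ, true_and] at hpm
      have h2 : ((A.proxSet i).filter (fun j => A.LinProx k j)).card ≤ 1 := by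
        refine Finset.card_le_one.2 fun j hj j' hj' => ?_
        have hpar {j : Fin r} (hj : j ∈ (A.proxSet i).filter (fun j => A.LinProx k j)) :
            j = A.parent k := by
          by_contra hne
          obtain ⟨hj, a', b', hab', hc'⟩ := mem_filter.1 hj
          obtain ⟨t, ht⟩ := prox_iff _ |>.1 (mem_filter.1 hj).2
          exact (A.lt_of_cone_eq_v ht).ne
            (inChain_unique hpm.1 hab' hpm.2 hc' hp (Ne.symm hne)).1
        rw [hpar hj, hpar hj']
      omega

lemma sum_linProx_add_sum_M_le (i : Fin r) :
    ∑ j ∈ A.proxSet i, ∑ k ∈ (A.proxSet i).filter (fun k => A.LinProx k j), A.m k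
      + ∑ p ∈ labelPairs, A.M i p.1 p.2 ≤ 2 * ∑ k ∈ A.proxSet i, A.m k := by
  have h1 : ∑ j ∈ A.proxSet i, ∑ k ∈ (A.proxSet i).filter (fun k => A.LinProx k j), A.m k
      = ∑ k ∈ A.proxSet i, ((A.proxSet i).filter (fun j => A.LinProx k j)).card * A.m k := by
    simp_rw [Finset.sum_filter]
    rw [Finset.sum_comm]
    simp_rw [← Finset.sum_filter, Finset.sum_const, nsmul_eq_mul]
  have h2 : ∑ p ∈ labelPairs, A.M i p.1 p.2 = ∑ k ∈ A.proxSet i,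
      (labelPairs.filter (fun p => A.inChain i p.1 p.2 k = true)).card * A.m k := by
    have h3 : ∀ p ∈ labelPairs, A.M i p.1 p.2 =
        ∑ k ∈ A.proxSet i, if A.inChain i p.1 p.2 k = true then A.m k else 0 := by
      intro p hp
      rw [M, ← Finset.sum_filter]
      refine Finset.sum_congr ?_ fun _ _ => rfl
      ext k
      simp only [proxSet, mem_filter, mem_univ, true_and, prox_iff]
      exact ⟨fun h => ⟨⟨_, cone_of_inChain (mem_filter.1 hp).2 h⟩, h⟩, fun h => h.2⟩
    rw [Finset.sum_congr rfl h3, Finset.sum_comm]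
    simp_rw [← Finset.sum_filter, Finset.sum_const, nsmul_eq_mul]
  rw [h1, h2, ← Finset.sum_add_distrib, Finset.mul_sum]
  refine Finset.sum_le_sum fun k _ => ?_
  rw [← add_mul]
  have := card_linProx_add_card_chains_le (A := A) i k
  exact mul_le_mul_of_nonneg_right (by exact_mod_cast this) (A.m_pos k).le

/-- A chain starting at `i` and staying in the exceptional component of `j`, where `v j` occupies
the slot `a` of the cone of `i`, avoids the label `a`. -/
lemma slot_of_inChain {i j k : Fin r} {a s x y : Fin 3} (hi : A.cone i a = A.v j)
    (hxy : x ≠ y) (hc : A.inChain i x y k = true) (hk : A.cone k s = A.v j) :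
    s = a ∧ x ≠ a ∧ (A.parent k ≠ i → y ≠ a) := by
  have hji := A.lt_of_cone_eq_v hi
  obtain ⟨hk0, ⟨hp, hl⟩ | ⟨hl, hp⟩⟩ := inChain_iff.1 hc
  · obtain ⟨-, h | h⟩ := A.cone_eq_v_iff.1 hk
    · exact absurd (hp.symm.trans h.2) hji.ne'
    · have hs : s = a := A.cone_injective i (by rw [hi, ← h.2, hp])
      exact ⟨hs, fun he => h.1 (by rw [hl, he, hs]), fun hne => absurd hp hne⟩
  · obtain ⟨-, h | h⟩ := A.cone_eq_v_iff.1 hk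
    · exact absurd (h.2 ▸ lt_of_inChain hp) (lt_asymm hji)
    · obtain ⟨hs, hx, -⟩ := slot_of_inChain hi hxy hp h.2
      exact ⟨hs, hx, fun _ he => h.1 (by rw [hl, he, hs])⟩
termination_by (k : ℕ)
decreasing_by exact A.parent_lt k hk0

lemma sum_linProx_le (hA : A.Idealistic) {i j : Fin r} (hj : j ∈ A.Bset i) :
    ∑ k ∈ (A.proxSet j).filter (fun k => A.LinProx k i), A.m k ≤ A.m i := by
  obtain ⟨a, ha⟩ := prox_iff _ |>.1 (mem_filter.1 hj).2
  obtain ⟨b, c, hba, hca, hbc, hall⟩ : ∃ b c : Fin 3, b ≠ a ∧ c ≠ a ∧ b ≠ c ∧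
      ∀ x, x ≠ a → x = b ∨ x = c := by
    have key : ∀ a : Fin 3, ∃ b c : Fin 3, b ≠ a ∧ c ≠ a ∧ b ≠ c ∧
        ∀ x, x ≠ a → x = b ∨ x = c := by decide
    exact key a
  have hsub : (A.proxSet j).filter (fun k => A.LinProx k i) ⊆
      univ.filter (fun k => A.inChain i b c k = true) ∪
        univ.filter (fun k => A.inChain i c b k = true) := by
    intro k hk
    simp only [proxSet, mem_filter, mem_univ, true_and, prox_iff] at hk
    obtain ⟨⟨s, hs⟩, x, y, hxy, hc⟩ := hk
    obtain ⟨-, hx, hy⟩ := slot_of_inChain ha hxy hc hs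
    simp only [mem_union, mem_filter, mem_univ, true_and]
    by_cases hp : A.parent k = i
    · obtain ⟨hk0, h | h⟩ := inChain_iff.1 hc
      · rcases hall x hx with rfl | rfl
        · exact Or.inl (inChain_iff.2 ⟨hk0, Or.inl h⟩)
        · exact Or.inr (inChain_iff.2 ⟨hk0, Or.inl h⟩)
      · exact absurd (hp ▸ lt_of_inChain h.2) (lt_irrefl _)
    · rcases hall x hx with rfl | rfl <;> rcases hall y (hy hp) with rfl | rfl
      · exact absurd rfl hxy
      · exact Or.inl hc
      · exact Or.inr hc
      · exact absurd rfl hxy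
  calc _ ≤ _ := Finset.sum_le_sum_of_subset_of_nonneg hsub fun k _ _ => (A.m_pos k).le
    _ ≤ A.M i b c + A.M i c b := by
      rw [M, M, ← Finset.sum_union_inter]
      exact le_add_of_nonneg_right (Finset.sum_nonneg fun k _ => (A.m_pos k).le)
    _ ≤ A.m i := hA i b c hbc

lemma T_nonneg (i : Fin r) : 0 ≤ A.T i := by
  have hslot : ∀ j ∈ A.Bset i, ∃ a, A.cone i a = A.v j := fun j hj =>
    prox_iff _ |>.1 (mem_filter.1 hj).2
  choose! σ hσ using hslot
  have hinj : Set.InjOn σ (A.Bset i) := fun j hj j' hj' h =>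
    A.v_injective (by rw [← hσ j hj, ← hσ j' hj', h])
  have hA' : (A.Aset i).card ≤ (univ.filter fun a => (A.Bset i).image σ ⊆ {a}).card := by
    refine Finset.card_le_card_of_injOn A.label ?_ ?_
    · intro k hk
      simp only [Aset, coe_filter, Set.mem_ofPred_eq, mem_univ, true_and] at hk
      simp only [coe_filter, Set.mem_ofPred_eq, mem_univ, true_and, Finset.image_subset_iff,
        mem_singleton]
      intro l hl
      by_contra hne
      refine hk.2 ⟨l, (mem_filter.1 hl).2, A.prox_iff.2 ⟨σ l, ?_⟩⟩
      rw [A.cone_of_ne_label hk.1.1 hne, hk.1.2, hσ l hl]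
    · intro k hk k' hk' h
      simp only [Aset, coe_filter, Set.mem_ofPred_eq, mem_univ, true_and] at hk hk'
      exact hk.1.eq_of_label_eq hk'.1 h
  have hB : (A.Bset i).card = ((A.Bset i).image σ).card := (Finset.card_image_of_injOn hinj).symm
  have key : ∀ L : Finset (Fin 3), 2 * L.card + (univ.filter fun a => L ⊆ {a}).card
      ≤ 3 + L.card.choose 2 := by decide
  have := key ((A.Bset i).image σ)
  rw [← hB] at this
  unfold T
  omega

/-- Up to non-negative terms, `χ_i` is `m_i²` minus the squared weights of the nodes proximate to
`i` and minus the gaps in the linear proximity inequalities at `i`. -/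
lemma le_chi (hA : A.Idealistic) (i : Fin r) :
    A.m i ^ 2 - ∑ k ∈ A.proxSet i, A.m k ^ 2
      - (A.rab i 0 1 + A.rab i 0 2 + A.rab i 1 2) ≤ A.chi i := by
  have h1 := A.sum_linProx_add_sum_M_le i
  have h2 : 0 ≤ ∑ j ∈ A.Bset i,
      (A.m i - ∑ k ∈ (A.proxSet j).filter (fun k => A.LinProx k i), A.m k) :=
    Finset.sum_nonneg fun j hj => sub_nonneg.2 (sum_linProx_le hA hj)
  have h3 := A.T_nonneg i
  have h4 : ∑ p ∈ labelPairs, A.M i p.1 p.2 = A.M i 0 1 + A.M i 1 0 + A.M i 0 2 + A.M i 2 0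
      + A.M i 1 2 + A.M i 2 1 := by
    rw [labelPairs, Finset.sum_filter, Fintype.sum_prod_type]
    simp [Fin.sum_univ_three]
    ring
  have h5 : ∑ j ∈ A.proxSet i, A.m j * (A.m j - 1)
      = ∑ k ∈ A.proxSet i, A.m k ^ 2 - ∑ k ∈ A.proxSet i, A.m k := by
    rw [← Finset.sum_sub_distrib]
    exact Finset.sum_congr rfl fun k _ => by ring
  unfold chi
  unfold T at h3
  rw [h5, Finset.sum_sub_distrib]
  unfold rab
  linarith

end ToricCluster

/-- Cutting off three corners of a triangle of side `d` leaves more area than the boundary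
remaining on its sides. -/
lemma gaps_lt_of_three_corners {d x₁ x₂ y₁ y₂ z₁ z₂ : ℤ} (hx₁ : 1 ≤ x₁) (hx₂ : 1 ≤ x₂)
    (hy₁ : 1 ≤ y₁) (hy₂ : 1 ≤ y₂) (hz₁ : 1 ≤ z₁) (hz₂ : 1 ≤ z₂) (hxy : x₁ + y₁ ≤ d)
    (hxz : x₂ + z₁ ≤ d) (hyz : y₂ + z₂ ≤ d) :
    (d - x₁ - y₁) + (d - x₂ - z₁) + (d - y₂ - z₂) < d ^ 2 - x₁ * x₂ - y₁ * y₂ - z₁ * z₂ := by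
  have h1 := mul_nonneg (sub_nonneg.2 hxy) (sub_nonneg.2 hx₂)
  have h2 := mul_nonneg (sub_nonneg.2 hxz) (show 0 ≤ d - y₁ - 1 by linarith)
  have h3 := mul_nonneg (sub_nonneg.2 hyz) (sub_nonneg.2 hy₁)
  have h4 : 0 < z₁ * (d - y₁ - z₂) + z₂ * y₁ := by
    rcases le_or_gt 0 (d - y₁ - z₂) with h | h
    · nlinarith [mul_nonneg (show 0 ≤ z₁ by linarith) h]
    · nlinarith [mul_pos (show 0 < d - z₁ by linarith) (neg_pos.2 h),
        mul_pos (show 0 < d - y₁ by linarith) (show 0 < d - z₂ by linarith)]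
  linarith

/-- Cutting off two corners of a triangle of side `d`, one of them by a region strictly smaller
than the corresponding triangle, leaves more area than the boundary remaining on its sides. -/
lemma gaps_lt_of_two_corners {d x₁ x₂ y₁ y₂ s : ℤ} (hx₁ : 1 ≤ x₁)
    (hy₁ : 1 ≤ y₁) (hxy : x₁ + y₁ ≤ d)
    (hx : x₂ ≤ d) (hy : y₂ ≤ d) (hs : s < x₁ * x₂ + y₁ * y₂) :
    (d - x₁ - y₁) + (d - x₂) + (d - y₂) < d ^ 2 - s := by
  have h1 := mul_nonneg (sub_nonneg.2 hxy) (show 0 ≤ d - 1 by linarith)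
  have h2 := mul_nonneg (sub_nonneg.2 hx) (sub_nonneg.2 hx₁)
  have h3 := mul_nonneg (sub_nonneg.2 hy) (sub_nonneg.2 hy₁)
  linarith

theorem stmt0 {r : ℕ} (A : ToricCluster r) (hA : A.Idealistic) (i : Fin r)
    (h : ∀ a b : Fin 3, a ≠ b →
      3 ≤ (Finset.univ.filter
            (fun j => inChain A.toToricConstellation i a b j = true)).card
        + (Finset.univ.filter
            (fun j => inChain A.toToricConstellation i b a j = true)).card) :
    0 < A.chi i := by
  refine lt_of_lt_of_le ?_ (le_chi hA i)
  have hsum := sum_proxSet (A := A) i fun k => A.m k ^ 2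
  rw [Fin.sum_univ_three] at hsum
  simp only [filter_inChain] at h
  have h01 := h 0 1 (by decide)
  have h02 := h 0 2 (by decide)
  have h12 := h 1 2 (by decide)
  have r01 := hA i 0 1 (by decide)
  have r02 := hA i 0 2 (by decide)
  have r12 := hA i 1 2 (by decide)
  unfold rab
  rcases branch_estimate hA i (a := 0) (b := 1) (c := 2) (by decide) (by decide) with
    ⟨n01, n02, x₁, x₂, sx⟩ | ⟨x₁, x₂, sx, tx⟩ <;>
  rcases branch_estimate hA i (a := 1) (b := 0) (c := 2) (by decide) (by decide) with
    ⟨n10, n12, y₁, y₂, sy⟩ | ⟨y₁, y₂, sy, ty⟩ <;>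
  rcases branch_estimate hA i (a := 2) (b := 0) (c := 1) (by decide) (by decide) with
    ⟨n20, n21, z₁, z₂, sz⟩ | ⟨z₁, z₂, sz, tz⟩
  · omega
  · omega
  · omega
  · have hs : ∑ k ∈ A.proxSet i, A.m k ^ 2 <
        A.M i 1 2 * A.M i 1 0 + A.M i 2 1 * A.M i 2 0 := by
      rcases (by omega : 2 ≤ (A.branch {2} i 1).card ∨ 2 ≤ (A.branch {1} i 2).card) with hn | hn
      · linarith [ty (by omega) hn]
      · linarith [tz (by omega) hn]
    linarith [gaps_lt_of_two_corners y₂ z₂ r12 (by linarith) (by linarith) hs]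
  · omega
  · have hs : ∑ k ∈ A.proxSet i, A.m k ^ 2 <
        A.M i 0 2 * A.M i 0 1 + A.M i 2 0 * A.M i 2 1 := by
      rcases (by omega : 2 ≤ (A.branch {2} i 0).card ∨ 2 ≤ (A.branch {0} i 2).card) with hn | hn
      · linarith [tx (by omega) hn]
      · linarith [tz hn (by omega)]
    linarith [gaps_lt_of_two_corners x₂ z₁ r02 (by linarith) (by linarith) hs]
  · have hs : ∑ k ∈ A.proxSet i, A.m k ^ 2 <
        A.M i 0 1 * A.M i 0 2 + A.M i 1 0 * A.M i 1 2 := by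
      rcases (by omega : 2 ≤ (A.branch {1} i 0).card ∨ 2 ≤ (A.branch {0} i 1).card) with hn | hn
      · linarith [tx hn (by omega)]
      · linarith [ty hn (by omega)]
    linarith [gaps_lt_of_two_corners x₁ y₁ r01 (by linarith) (by linarith) hs]
  · linarith [gaps_lt_of_three_corners x₁ x₂ y₁ y₂ z₁ z₂ r01 r02 r12]
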